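/- Let G and Q be groups with finitely generated abelianizations, let n be a natural number, and let l : ℤ^n → G and f : G → Q be group homomorphisms such that f is surjective, the image of l equals the kernel of f, and rank(G^{ab}) − rank(Q^{ab}) = n. Suppose moreover that the induced sequence 0 → ℤ^n → G^{ab} → Q^{ab} → 0 on abelianizations splits, i.e. there is a homomorphism j : Q^{ab} → G^{ab} with f^{ab} ∘ j = id. Then the sequence 0 → ℤ^n → G → Q → 0 splits: there exists a normal subgroup G' of G such that G is the internal direct product of l(ℤ^n) and G' (every element of l(ℤ^n) commutes with every element of G', l(ℤ^n) ∩ G' = {1}, and l(ℤ^n)·G' = G) and the restriction of f to G' is an isomorphism onto Q. -/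

import Mathlib

open TensorProduct Pointwise

/-- The rank of the abelianization of a group `G`, i.e. `dim_ℚ (ℚ ⊗_ℤ G^{ab})`. -/
noncomputable def abRank (G : Type*) [Group G] : ℕ :=
  Module.finrank ℚ (ℚ ⊗[ℤ] Additive (Abelianization G))

theorem abRank_eq_finrank_int (G : Type*) [Group G] :
    abRank G = Module.finrank ℤ (Additive (Abelianization G)) :=
  (TensorProduct.isBaseChange ℤ (Additive (Abelianization G)) ℚ).finrank_eq

theorem LinearMap.ker_eq_bot_of_range_eq_ker_of_finrank_add {R P M N : Type*} [CommRing R]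
    [IsDomain R] [IsNoetherianRing R] [AddCommGroup P] [AddCommGroup M] [AddCommGroup N]
    [Module R P] [Module R M] [Module R N] [Module.Finite R P] [Module.IsTorsionFree R P]
    [Module.Finite R M] (φ : P →ₗ[R] M) (ψ : M →ₗ[R] N) (hψ : Function.Surjective ψ)
    (hφψ : φ.range = ψ.ker)
    (hrank : Module.finrank R P + Module.finrank R N = Module.finrank R M) :
    φ.ker = ⊥ := by
  have h₁ := Submodule.finrank_quotient_add_finrank φ.ker
  have h₂ := Submodule.finrank_quotient_add_finrank ψ.ker
  rw [φ.quotKerEquivRange.finrank_eq, hφψ] at h₁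
  rw [(ψ.quotKerEquivOfSurjective hψ).finrank_eq] at h₂
  rw [← Submodule.finrank_eq_zero (R := R)]
  omega

theorem Abelianization.map_surjective {G Q : Type*} [Group G] [Group Q] {f : G →* Q}
    (hf : Function.Surjective f) : Function.Surjective (Abelianization.map f) := by
  intro y
  obtain ⟨q, rfl⟩ := QuotientGroup.mk_surjective y
  obtain ⟨g, rfl⟩ := hf q
  exact ⟨Abelianization.of g, Abelianization.map_of f g⟩

/-- Right exactness of abelianization. -/
theorem Abelianization.ker_map_of_surjective {G Q : Type*} [Group G] [Group Q] {f : G →* Q}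
    (hf : Function.Surjective f) :
    (Abelianization.map f).ker = f.ker.map Abelianization.of := by
  ext x
  obtain ⟨g, rfl⟩ := QuotientGroup.mk_surjective x
  constructor
  · intro hg
    have hg : f g ∈ commutator Q := by
      rw [← Abelianization.ker_of, MonoidHom.mem_ker, ← Abelianization.map_of]
      exact hg
    rw [commutator_def, ← Subgroup.map_top_of_surjective f hf, ← Subgroup.map_commutator,
      ← commutator_def] at hg
    obtain ⟨c, hc, hcg⟩ := hg
    refine ⟨g * c⁻¹, by simp [MonoidHom.mem_ker, hcg], ?_⟩
    have hc' : Abelianization.of c = 1 := by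
      rwa [← MonoidHom.mem_ker, Abelianization.ker_of]
    rw [map_mul, map_inv, hc', inv_one, mul_one]
    rfl
  · rintro ⟨k, hk, hkg⟩
    rw [← hkg, MonoidHom.mem_ker, Abelianization.map_of, show f k = 1 from hk, map_one]

theorem Subgroup.commute_of_normal_of_disjoint_commutator {G : Type*} [Group G] {H : Subgroup G}
    [H.Normal] (hH : Disjoint H (_root_.commutator G)) {a : G} (ha : a ∈ H) (b : G) : Commute a b := by
  rw [← commutatorElement_eq_one_iff_commute, ← Subgroup.mem_bot, ← hH.eq_bot]
  exact ⟨Subgroup.commutator_le_left H ⊤ (Subgroup.commutator_mem_commutator ha trivial),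
    Subgroup.commutator_mem_commutator trivial trivial⟩

theorem homotopy_sequence_splits_of_homology_sequence_splits
    {G Q : Type*} [Group G] [Group Q] (n : ℕ)
    [Group.FG (Abelianization G)] [Group.FG (Abelianization Q)]
    (l : Multiplicative (Fin n → ℤ) →* G) (f : G →* Q)
    (hf : Function.Surjective f) (hlf : l.range = f.ker)
    (hrank : (abRank G : ℤ) - (abRank Q : ℤ) = n)
    (j : Abelianization Q →* Abelianization G)
    (hj : (Abelianization.map f).comp j = MonoidHom.id (Abelianization Q)) :
    ∃ G' : Subgroup G, G'.Normal ∧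
      (∀ a ∈ l.range, ∀ b ∈ G', a * b = b * a) ∧
      l.range ⊓ G' = ⊥ ∧
      (l.range : Set G) * (G' : Set G) = Set.univ ∧
      Function.Bijective (fun x : G' => f x) := by
  have hfin : Module.Finite ℤ (Additive (Abelianization G)) := by
    rw [Module.Finite.iff_addGroup_fg]; infer_instance
  have hker := Abelianization.ker_map_of_surjective hf
  have hinj : Function.Injective (Abelianization.of.comp l) := by
    let φ : (Fin n → ℤ) →ₗ[ℤ] Additive (Abelianization G) :=
      (MonoidHom.toAdditiveRight (Abelianization.of.comp l)).toIntLinearMap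
    let ψ : Additive (Abelianization G) →ₗ[ℤ] Additive (Abelianization Q) :=
      (MonoidHom.toAdditive (Abelianization.map f)).toIntLinearMap
    have hφ : φ.ker = ⊥ := by
      refine φ.ker_eq_bot_of_range_eq_ker_of_finrank_add ψ (Abelianization.map_surjective hf) ?_ ?_
      · ext x
        have := SetLike.ext_iff.mp hker x.toMul
        rw [← hlf, ← MonoidHom.range_comp] at this
        exact this.symm
      · rw [abRank_eq_finrank_int, abRank_eq_finrank_int] at hrank
        rw [Module.finrank_fin_fun]
        omega
    exact LinearMap.ker_eq_bot.mp hφ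
  have hdisj : Disjoint l.range (commutator G) := by
    rw [Subgroup.disjoint_def]
    rintro _ ⟨a, rfl⟩ ha
    rw [← Abelianization.ker_of, MonoidHom.mem_ker] at ha
    rw [hinj (ha.trans (map_one (Abelianization.of.comp l)).symm), map_one]
  have hj' : ∀ y, Abelianization.map f (j y) = y := DFunLike.congr_fun hj
  have : l.range.Normal := hlf ▸ inferInstance
  have hinf : l.range ⊓ j.range.comap Abelianization.of = ⊥ := by
    rw [eq_bot_iff]
    rintro a ⟨ha, y, hy⟩
    refine Subgroup.disjoint_def.mp hdisj ha ?_
    have hy' := hj' y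
    rw [hlf] at ha
    rw [hy, Abelianization.map_of, show f a = 1 from ha, map_one] at hy'
    rw [← Abelianization.ker_of, MonoidHom.mem_ker, ← hy, ← hy', map_one]
  have hmul : ∀ g : G, ∃ a ∈ l.range, ∃ b ∈ j.range.comap Abelianization.of, a * b = g := by
    intro g
    have hk : Abelianization.of g * (j (Abelianization.of (f g)))⁻¹ ∈
        (Abelianization.map f).ker := by
      rw [MonoidHom.mem_ker, map_mul, map_inv, hj', Abelianization.map_of, mul_inv_cancel]
    rw [hker, ← hlf] at hk
    obtain ⟨a, ha, hag⟩ := hk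
    refine ⟨a, ha, a⁻¹ * g, ⟨Abelianization.of (f g), ?_⟩, mul_inv_cancel_left a g⟩
    rw [map_mul, map_inv, hag, mul_inv_rev, inv_inv, inv_mul_cancel_right]
  refine ⟨j.range.comap Abelianization.of, inferInstance,
    fun a ha b _ => Subgroup.commute_of_normal_of_disjoint_commutator hdisj ha b, hinf,
    Set.eq_univ_of_forall hmul, ?_, ?_⟩
  · refine (injective_iff_map_eq_one (f.comp (Subgroup.subtype _))).mpr fun x hx => ?_
    have hx' : (x : G) ∈ l.range ⊓ j.range.comap Abelianization.of :=
      ⟨hlf ▸ (hx : f x = 1), x.2⟩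
    rw [hinf] at hx'
    exact Subtype.ext hx'
  · intro q
    obtain ⟨g, rfl⟩ := hf q
    obtain ⟨a, ha, b, hb, rfl⟩ := hmul g
    rw [hlf] at ha
    exact ⟨⟨b, hb⟩, by simp [show f a = 1 from ha]⟩
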